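/- Let (𝒜, p) and (𝒜', p') be n𝒫-posets and let Σ : 𝒜 → Subd(𝒜') be a canonical subdivision over n𝒫. For an 𝒜-complex X define Σ*(X) := ⋃_{x ∈ X} Σ(x). Then Σ*(X) is an 𝒜'-complex with n-support equal to |X|ₙ; moreover the map X ↦ Σ*(X) from Subd(𝒜) to Subd(𝒜') is a canonical subdivision over n𝒫 (with respect to the n-support maps on these posets of subdivisions). -/

import Mathlib

open Pointwise

/-- A point of `ℝ^d` with integer coordinates. -/
def IsLatticePt {d : ℕ} (x : Fin d → ℝ) : Prop := ∀ i, ∃ z : ℤ, x i = (z : ℝ)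

/-- The subgroup `ℤ^d` of integral points of `ℝ^d`. -/
def intLattice (d : ℕ) : AddSubgroup (Fin d → ℝ) where
  carrier := {x | IsLatticePt x}
  zero_mem' := fun i => ⟨0, by simp⟩
  add_mem' := by
    rintro a b ha hb i
    obtain ⟨z, hz⟩ := ha i
    obtain ⟨w, hw⟩ := hb i
    exact ⟨z + w, by simp [hz, hw]⟩
  neg_mem' := by
    rintro a ha i
    obtain ⟨z, hz⟩ := ha i
    exact ⟨-z, by simp [hz]⟩

/-- A polytope: the convex hull of a nonempty finite set of points. -/
def IsPolytope {d : ℕ} (P : Set (Fin d → ℝ)) : Prop :=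
  ∃ V : Finset (Fin d → ℝ), V.Nonempty ∧ P = convexHull ℝ (V : Set (Fin d → ℝ))

/-- An integral polytope: the convex hull of a nonempty finite set of integral points. -/
def IsIntegralPolytope {d : ℕ} (P : Set (Fin d → ℝ)) : Prop :=
  ∃ V : Finset (Fin d → ℝ), V.Nonempty ∧ (∀ v ∈ V, IsLatticePt v) ∧
    P = convexHull ℝ (V : Set (Fin d → ℝ))

/-- A simplex: the convex hull of a nonempty affinely independent finite set. -/
def IsSimplex {d : ℕ} (P : Set (Fin d → ℝ)) : Prop :=
  ∃ V : Finset (Fin d → ℝ), V.Nonempty ∧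
    AffineIndependent ℝ (Subtype.val : ↥(V : Set (Fin d → ℝ)) → (Fin d → ℝ)) ∧
    P = convexHull ℝ (V : Set (Fin d → ℝ))

/-- An integral simplex. -/
def IsIntegralSimplex {d : ℕ} (P : Set (Fin d → ℝ)) : Prop :=
  ∃ V : Finset (Fin d → ℝ), V.Nonempty ∧ (∀ v ∈ V, IsLatticePt v) ∧
    AffineIndependent ℝ (Subtype.val : ↥(V : Set (Fin d → ℝ)) → (Fin d → ℝ)) ∧
    P = convexHull ℝ (V : Set (Fin d → ℝ))

/-- The set of differences of vertices (= extreme points) of a polytope. -/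
def vertexDiffs {d : ℕ} (P : Set (Fin d → ℝ)) : Set (Fin d → ℝ) :=
  {w | ∃ u ∈ P.extremePoints ℝ, ∃ v ∈ P.extremePoints ℝ, w = u - v}

/-- `L(P)`: the subgroup of `ℤ^d` generated by differences of vertices of `P`. -/
def latL {d : ℕ} (P : Set (Fin d → ℝ)) : AddSubgroup (Fin d → ℝ) :=
  AddSubgroup.closure (vertexDiffs P)

/-- `N(P)`: the intersection of the real span of `L(P)` with `ℤ^d`. -/
def latN {d : ℕ} (P : Set (Fin d → ℝ)) : AddSubgroup (Fin d → ℝ) :=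
  (Submodule.span ℝ (vertexDiffs P)).toAddSubgroup ⊓ intLattice d

/-- The (normalized) index of an integral polytope: the group index `[N(P) : L(P)]`. -/
noncomputable def polyIndex {d : ℕ} (P : Set (Fin d → ℝ)) : ℕ :=
  ((latL P).addSubgroupOf (latN P)).index

/-- A unimodular simplex: an integral simplex of index 1. -/
def IsUnimodularSimplex {d : ℕ} (P : Set (Fin d → ℝ)) : Prop :=
  IsIntegralSimplex P ∧ polyIndex P = 1

/-- `F` is a face of `P`: the (nonempty) set of maximizers on `P` of a linear functional. -/
def IsFaceOf {d : ℕ} (F P : Set (Fin d → ℝ)) : Prop :=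
  F.Nonempty ∧ ∃ φ : (Fin d → ℝ) →ₗ[ℝ] ℝ, F = {x ∈ P | ∀ y ∈ P, φ y ≤ φ x}

/-- A triangulation of `Q`: a finite, face-closed collection of simplices with union `Q`,
any two of which meet in a (possibly empty) common face. -/
def IsTriangulation {d : ℕ} (T : Set (Set (Fin d → ℝ))) (Q : Set (Fin d → ℝ)) : Prop :=
  T.Finite ∧ (∀ S ∈ T, IsSimplex S) ∧ ⋃₀ T = Q ∧
    (∀ S ∈ T, ∀ F, IsFaceOf F S → F ∈ T) ∧
    ∀ S₁ ∈ T, ∀ S₂ ∈ T, S₁ ∩ S₂ = ∅ ∨ (IsFaceOf (S₁ ∩ S₂) S₁ ∧ IsFaceOf (S₁ ∩ S₂) S₂)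

/-- A unimodular triangulation: all of its simplices are unimodular. -/
def IsUnimodularTriangulation {d : ℕ} (T : Set (Set (Fin d → ℝ))) (Q : Set (Fin d → ℝ)) : Prop :=
  IsTriangulation T Q ∧ ∀ S ∈ T, IsUnimodularSimplex S

/-- A polytopal complex. -/
def IsPolytopalComplex {d : ℕ} (X : Set (Set (Fin d → ℝ))) : Prop :=
  X.Finite ∧ (∀ P ∈ X, IsPolytope P) ∧
    (∀ P ∈ X, ∀ F, IsFaceOf F P → F ∈ X) ∧
    ∀ P ∈ X, ∀ Q ∈ X, P ≠ Q → intrinsicInterior ℝ P ∩ intrinsicInterior ℝ Q = ∅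

/-- The order on `n𝒫`: each `F i` is the (nonempty) face of `P i` with respect to one single
linear functional. -/
def NPFace {d n : ℕ} (F P : Fin n → Set (Fin d → ℝ)) : Prop :=
  ∃ φ : (Fin d → ℝ) →ₗ[ℝ] ℝ, ∀ i, (F i).Nonempty ∧ F i = {x ∈ P i | ∀ y ∈ P i, φ y ≤ φ x}

/-- The Minkowski sum of an `n`-tuple of subsets of `ℝ^d`. -/
def minkSum {d n : ℕ} (P : Fin n → Set (Fin d → ℝ)) : Set (Fin d → ℝ) :=
  ∑ i, P i

/-- `X` is an `𝒜`-complex for the `n𝒫`-poset `(𝒜, p)`: the Minkowski sums of the tuples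
`p x`, `x ∈ X`, form a polytopal complex, and `x ↦ Σ(p x)` is a poset isomorphism from `X`
onto this complex (ordered by the face relation). -/
def IsAComplex {d n : ℕ} {𝒜 : Type*} [PartialOrder 𝒜]
    (p : 𝒜 → Fin n → Set (Fin d → ℝ)) (X : Set 𝒜) : Prop :=
  IsPolytopalComplex ((fun x => minkSum (p x)) '' X) ∧
  Set.InjOn (fun x => minkSum (p x)) X ∧
  ∀ x ∈ X, ∀ y ∈ X, (x ≤ y ↔ IsFaceOf (minkSum (p x)) (minkSum (p y)))

/-- The support of an `𝒜`-complex. -/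
def suppOf {d n : ℕ} {𝒜 : Type*} (p : 𝒜 → Fin n → Set (Fin d → ℝ)) (X : Set 𝒜) :
    Set (Fin d → ℝ) :=
  ⋃ x ∈ X, minkSum (p x)

/-- The `n`-support of an `𝒜`-complex. -/
def nsuppOf {d n : ℕ} {𝒜 : Type*} (p : 𝒜 → Fin n → Set (Fin d → ℝ)) (X : Set 𝒜) :
    Fin n → Set (Fin d → ℝ) :=
  fun k => ⋃ x ∈ X, p x k

/-- An `𝒜`-subdivision: an `𝒜`-complex whose support is a polytope. -/
def IsASubdivision {d n : ℕ} {𝒜 : Type*} [PartialOrder 𝒜]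
    (p : 𝒜 → Fin n → Set (Fin d → ℝ)) (X : Set 𝒜) : Prop :=
  IsAComplex p X ∧ IsPolytope (suppOf p X)

/-- The order on `Subd(𝒜)`: `X'` is a subcomplex of `X` whose support is a face of the
support of `X`. -/
def SubdLE {d n : ℕ} {𝒜 : Type*} [PartialOrder 𝒜]
    (p : 𝒜 → Fin n → Set (Fin d → ℝ)) (X' X : Set 𝒜) : Prop :=
  X' ⊆ X ∧ IsAComplex p X' ∧ IsFaceOf (suppOf p X') (suppOf p X)

/-- A point of a convex set outside its relative interior is supported by a linear functional
that is not constant on the set. -/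
theorem exists_nonconstant_supporting {V : Type*} [NormedAddCommGroup V] [NormedSpace ℝ V]
    [FiniteDimensional ℝ V] {s : Set V} (hs : Convex ℝ s) {a : V} (ha : a ∈ s)
    (hai : a ∉ intrinsicInterior ℝ s) :
    ∃ φ : V →ₗ[ℝ] ℝ, (∀ y ∈ s, φ y ≤ φ a) ∧ ∃ y ∈ s, φ y < φ a := by
  have : Nonempty s := ⟨⟨a, ha⟩⟩
  let a' : affineSpan ℝ s := ⟨a, subset_affineSpan _ _ ha⟩
  let e := (AffineIsometryEquiv.constVSub ℝ a').symm
  let t : Set (affineSpan ℝ s) := (↑) ⁻¹' s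
  have he0 : e 0 = a' := by simp [e]
  have hint : interior (e ⁻¹' t) = e ⁻¹' interior t :=
    (e.toHomeomorph.preimage_interior t).symm
  have hne : (interior t).Nonempty := by
    have := Set.Nonempty.intrinsicInterior hs ⟨a, ha⟩
    rwa [intrinsicInterior, Set.image_nonempty] at this
  have hconv : Convex ℝ (e ⁻¹' t) :=
    hs.affine_preimage ((affineSpan ℝ s).subtype.comp e.toAffineEquiv.toAffineMap)
  have h0 : (0 : (affineSpan ℝ s).direction) ∉ interior (e ⁻¹' t) := by
    rw [hint, Set.mem_preimage, he0]
    exact fun h => hai ⟨a', h, rfl⟩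
  have hne' : (interior (e ⁻¹' t)).Nonempty := by
    rw [hint]
    obtain ⟨y, hy⟩ := hne
    exact ⟨e.symm y, by simpa using hy⟩
  obtain ⟨f, hf, hfle⟩ := geometric_hahn_banach_of_nonempty_interior_point hconv h0 hne'
  obtain ⟨φ, hφ⟩ := LinearMap.exists_extend
    (-(f : (affineSpan ℝ s).direction →ₗ[ℝ] ℝ))
  have hval : ∀ v : (affineSpan ℝ s).direction, φ v = -f v := fun v => LinearMap.congr_fun hφ v
  have hdiff : ∀ y ∈ s, a - y ∈ (affineSpan ℝ s).direction := fun y hy =>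
    AffineSubspace.vsub_mem_direction (subset_affineSpan _ _ ha) (subset_affineSpan _ _ hy)
  have hle : ∀ y ∈ s, φ y ≤ φ a := by
    intro y hy
    have h1 : (⟨a - y, hdiff y hy⟩ : (affineSpan ℝ s).direction) ∈ e ⁻¹' t := by
      simp only [Set.mem_preimage, t, e]
      simpa [a'] using hy
    have h2 := hfle _ h1
    have h3 := hval ⟨a - y, hdiff y hy⟩
    rw [map_zero] at h2
    rw [map_sub] at h3
    linarith
  refine ⟨φ, hle, ?_⟩
  by_contra! hcon
  have hconst : ∀ y ∈ s, φ y = φ a := fun y hy => (hle y hy).antisymm (hcon y hy)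
  have hker : (affineSpan ℝ s).direction ≤ LinearMap.ker φ := by
    rw [direction_affineSpan, vectorSpan_def, Submodule.span_le]
    rintro _ ⟨y, hy, z, hz, rfl⟩
    simp [hconst y hy, hconst z hz]
  apply hf
  ext v
  simpa [hval] using hker v.2

section Polytope

variable {d n : ℕ}

theorem IsPolytope.convex {P : Set (Fin d → ℝ)} (h : IsPolytope P) : Convex ℝ P := by
  obtain ⟨V, -, rfl⟩ := h
  exact convex_convexHull ℝ _

theorem IsPolytope.isCompact {P : Set (Fin d → ℝ)} (h : IsPolytope P) : IsCompact P := by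
  obtain ⟨V, -, rfl⟩ := h
  exact V.finite_toSet.isCompact_convexHull ℝ

theorem IsPolytope.nonempty {P : Set (Fin d → ℝ)} (h : IsPolytope P) : P.Nonempty := by
  obtain ⟨V, hV, rfl⟩ := h
  exact (convexHull_nonempty_iff (𝕜 := ℝ)).2 hV

theorem IsPolytope.exists_max {P : Set (Fin d → ℝ)} (h : IsPolytope P)
    (φ : (Fin d → ℝ) →ₗ[ℝ] ℝ) : ∃ m ∈ P, ∀ y ∈ P, φ y ≤ φ m :=
  h.isCompact.exists_isMaxOn h.nonempty φ.continuous_of_finiteDimensional.continuousOn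

theorem mem_minkSum {P : Fin n → Set (Fin d → ℝ)} {a : Fin d → ℝ} :
    a ∈ minkSum P ↔ ∃ g : Fin n → Fin d → ℝ, (∀ i, g i ∈ P i) ∧ ∑ i, g i = a := by
  simp [minkSum, Set.mem_fintype_sum]

theorem minkSum_mono {P Q : Fin n → Set (Fin d → ℝ)} (h : ∀ i, P i ⊆ Q i) :
    minkSum P ⊆ minkSum Q := by
  intro a ha
  obtain ⟨g, hg, rfl⟩ := mem_minkSum.1 ha
  exact mem_minkSum.2 ⟨g, fun i => h i (hg i), rfl⟩

theorem NPFace.subset {F P : Fin n → Set (Fin d → ℝ)} (h : NPFace F P) (i : Fin n) :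
    F i ⊆ P i := by
  obtain ⟨φ, hφ⟩ := h
  rw [(hφ i).2]
  exact Set.sep_subset _ _

theorem IsFaceOf.subset {F P : Set (Fin d → ℝ)} (h : IsFaceOf F P) : F ⊆ P := by
  obtain ⟨-, φ, rfl⟩ := h
  exact Set.sep_subset _ _

/-- If `φ (g i) ≤ φ (m i)` for all `i` and `φ` is as large on the sum of `g` as on that of `m`,
then all the inequalities are equalities. -/
theorem apply_eq_of_sum_eq {φ : (Fin d → ℝ) →ₗ[ℝ] ℝ} {g m : Fin n → Fin d → ℝ}
    (hle : ∀ i, φ (g i) ≤ φ (m i)) (hsum : φ (∑ i, m i) ≤ φ (∑ i, g i)) (i : Fin n) :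
    φ (g i) = φ (m i) := by
  simp only [map_sum] at hsum
  exact (Finset.sum_eq_sum_iff_of_le fun i _ => hle i).1
    ((Finset.sum_le_sum fun i _ => hle i).antisymm hsum) i (Finset.mem_univ i)

/-- The Minkowski sum of a face of a tuple is a face of the Minkowski sum. -/
theorem NPFace.isFaceOf_minkSum {F P : Fin n → Set (Fin d → ℝ)} (h : NPFace F P) :
    IsFaceOf (minkSum F) (minkSum P) := by
  obtain ⟨φ, hφ⟩ := h
  choose m hm using fun i => (hφ i).1
  have hm' : ∀ i, m i ∈ P i ∧ ∀ y ∈ P i, φ y ≤ φ (m i) := fun i => by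
    have := hm i
    rwa [(hφ i).2] at this
  refine ⟨⟨_, mem_minkSum.2 ⟨m, hm, rfl⟩⟩, φ, ?_⟩
  ext a
  constructor
  · intro ha
    obtain ⟨g, hg, rfl⟩ := mem_minkSum.1 ha
    have hg' : ∀ i, g i ∈ P i ∧ ∀ y ∈ P i, φ y ≤ φ (g i) := fun i => by
      have := hg i
      rwa [(hφ i).2] at this
    refine ⟨mem_minkSum.2 ⟨g, fun i => (hg' i).1, rfl⟩, fun y hy => ?_⟩
    obtain ⟨k, hk, rfl⟩ := mem_minkSum.1 hy
    simp only [map_sum]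
    exact Finset.sum_le_sum fun i _ => (hg' i).2 _ (hk i)
  · rintro ⟨ha, hmax⟩
    obtain ⟨g, hg, rfl⟩ := mem_minkSum.1 ha
    have heq := apply_eq_of_sum_eq (fun i => (hm' i).2 _ (hg i))
      (hmax _ (mem_minkSum.2 ⟨m, fun i => (hm' i).1, rfl⟩))
    refine mem_minkSum.2 ⟨g, fun i => ?_, rfl⟩
    rw [(hφ i).2]
    exact ⟨hg i, fun y hy => (heq i).symm ▸ (hm' i).2 y hy⟩

end Polytope

namespace IsAComplex

variable {d n : ℕ} {𝒜 : Type*} [PartialOrder 𝒜] {p : 𝒜 → Fin n → Set (Fin d → ℝ)} {X : Set 𝒜}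

theorem finite (hX : IsAComplex p X) : X.Finite :=
  Set.Finite.of_finite_image hX.1.1 hX.2.1

theorem isPolytope (hX : IsAComplex p X) {x : 𝒜} (hx : x ∈ X) : IsPolytope (minkSum (p x)) :=
  hX.1.2.1 _ ⟨x, hx, rfl⟩

theorem isCompact_suppOf (hX : IsAComplex p X) : IsCompact (suppOf p X) :=
  hX.finite.isCompact_biUnion fun _ hx => (hX.isPolytope hx).isCompact

theorem exists_le_of_isFaceOf (hX : IsAComplex p X) {x : 𝒜} (hx : x ∈ X) {F : Set (Fin d → ℝ)}
    (hF : IsFaceOf F (minkSum (p x))) : ∃ z ∈ X, z ≤ x ∧ minkSum (p z) = F := by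
  obtain ⟨z, hz, hzF⟩ := hX.1.2.2.1 _ ⟨x, hx, rfl⟩ F hF
  dsimp only at hzF
  exact ⟨z, hz, (hX.2.2 z hz x hx).2 (hzF ▸ hF), hzF⟩

theorem subset_of_le (hX : IsAComplex p X) {x y : 𝒜} (hx : x ∈ X) (hy : y ∈ X) (hxy : x ≤ y) :
    minkSum (p x) ⊆ minkSum (p y) :=
  ((hX.2.2 x hx y hy).1 hxy).subset

theorem eq_of_mem_intrinsicInterior (hX : IsAComplex p X) {x y : 𝒜} (hx : x ∈ X) (hy : y ∈ X)
    {a : Fin d → ℝ} (hax : a ∈ intrinsicInterior ℝ (minkSum (p x)))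
    (hay : a ∈ intrinsicInterior ℝ (minkSum (p y))) : x = y := by
  refine hX.2.1 hx hy ?_
  by_contra hne
  exact (hX.1.2.2.2 _ ⟨x, hx, rfl⟩ _ ⟨y, hy, rfl⟩ hne).le ⟨hax, hay⟩

/-- Every point of a cell lies in the relative interior of one of its faces. -/
theorem exists_carrier (hX : IsAComplex p X) {x : 𝒜} (hx : x ∈ X) {a : Fin d → ℝ}
    (ha : a ∈ minkSum (p x)) :
    ∃ z ∈ X, z ≤ x ∧ a ∈ intrinsicInterior ℝ (minkSum (p z)) := by
  have hfin : {z | z ∈ X ∧ z ≤ x ∧ a ∈ minkSum (p z)}.Finite := hX.finite.subset fun z hz => hz.1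
  obtain ⟨z, hz⟩ := hfin.exists_minimal ⟨x, hx, le_rfl, ha⟩
  obtain ⟨hzX, hzx, haz⟩ := hz.prop
  refine ⟨z, hzX, hzx, ?_⟩
  by_contra hai
  obtain ⟨φ, hφ, y, hy, hlt⟩ := exists_nonconstant_supporting (hX.isPolytope hzX).convex haz hai
  have hface : IsFaceOf {c ∈ minkSum (p z) | ∀ b ∈ minkSum (p z), φ b ≤ φ c} (minkSum (p z)) :=
    ⟨⟨a, haz, hφ⟩, φ, rfl⟩
  obtain ⟨w, hw, hwz, hweq⟩ := hX.exists_le_of_isFaceOf hzX hface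
  have haw : a ∈ minkSum (p w) := hweq ▸ ⟨haz, hφ⟩
  have hzw : z ≤ w := hz.le_of_le ⟨hw, hwz.trans hzx, haw⟩ hwz
  have hyw : y ∈ minkSum (p w) := hX.subset_of_le hzX hw hzw hy
  rw [hweq] at hyw
  exact hlt.not_ge (hyw.2 a haz)

/-- A cell whose relative interior meets another cell is a face of it. -/
theorem le_of_mem_intrinsicInterior (hX : IsAComplex p X) {z x : 𝒜} (hz : z ∈ X) (hx : x ∈ X)
    {a : Fin d → ℝ} (haz : a ∈ intrinsicInterior ℝ (minkSum (p z))) (hax : a ∈ minkSum (p x)) :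
    z ≤ x := by
  obtain ⟨w, hw, hwx, haw⟩ := hX.exists_carrier hx hax
  exact hX.eq_of_mem_intrinsicInterior hz hw haz haw ▸ hwx

end IsAComplex

/-- The Minkowski sum of the `n`-support of a complex with convex support is its support. -/
theorem IsAComplex.minkSum_nsuppOf {d n : ℕ} {𝒜 : Type*} [PartialOrder 𝒜]
    {p : 𝒜 → Fin n → Set (Fin d → ℝ)} {X : Set 𝒜} (hpoly : ∀ x i, IsPolytope (p x i))
    (hmono : ∀ x y : 𝒜, x ≤ y → NPFace (p x) (p y)) (hX : IsAComplex p X)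
    (hconv : Convex ℝ (suppOf p X)) (hne : X.Nonempty) :
    minkSum (nsuppOf p X) = suppOf p X := by
  apply Set.Subset.antisymm
  swap
  · exact Set.iUnion₂_subset fun x hx => minkSum_mono fun i => Set.subset_biUnion_of_mem
      (u := fun x => p x i) hx
  intro a ha
  by_contra hna
  obtain ⟨φ', u, hφu, hua⟩ :=
    geometric_hahn_banach_closed_point hconv hX.isCompact_suppOf.isClosed hna
  obtain ⟨φ, hφ⟩ : ∃ φ : (Fin d → ℝ) →ₗ[ℝ] ℝ, ∀ v, φ v = φ' v := ⟨φ', fun _ => rfl⟩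
  simp only [← hφ] at hφu hua
  choose m hm hmax using fun x i => (hpoly x i).exists_max φ
  have hsum_mem : ∀ x, ∑ i, m x i ∈ minkSum (p x) := fun x => mem_minkSum.2 ⟨m x, hm x, rfl⟩
  have hle_sum : ∀ x, ∀ c ∈ minkSum (p x), φ c ≤ φ (∑ i, m x i) := by
    intro x c hc
    obtain ⟨g, hg, rfl⟩ := mem_minkSum.1 hc
    simp only [map_sum]
    exact Finset.sum_le_sum fun i _ => hmax x i _ (hg i)
  have hmem_supp : ∀ {x}, x ∈ X → ∀ c ∈ minkSum (p x), c ∈ suppOf p X := fun hx c hc =>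
    Set.mem_biUnion hx hc
  have hle : ∀ {x y}, x ≤ y → ∀ i, φ (m x i) ≤ φ (m y i) := fun hxy i =>
    hmax _ _ _ ((hmono _ _ hxy).subset i (hm _ i))
  have heq_of_le : ∀ {x y}, x ≤ y → φ (∑ i, m y i) ≤ φ (∑ i, m x i) →
      ∀ i, φ (m x i) = φ (m y i) := fun hxy h => apply_eq_of_sum_eq (hle hxy) h
  have htop : ∀ {x}, x ∈ X → ∃ z ∈ X, z ≤ x ∧
      minkSum (p z) = {c ∈ minkSum (p x) | ∀ b ∈ minkSum (p x), φ b ≤ φ c} := fun {x} hx =>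
    hX.exists_le_of_isFaceOf hx ⟨⟨_, hsum_mem x, hle_sum x⟩, φ, rfl⟩
  -- a cell not reaching the top of the support is dominated by a higher one
  have hclimb : ∀ {x}, x ∈ X → ∀ b ∈ suppOf p X, φ (∑ i, m x i) < φ b →
      ∃ y ∈ X, (∀ i, φ (m x i) ≤ φ (m y i)) ∧ φ (∑ i, m x i) < φ (∑ i, m y i) := by
    intro x hx b hb hlt
    obtain ⟨z, hz, hzx, hzeq⟩ := htop hx
    obtain ⟨c, hc⟩ := (hX.isPolytope hz).nonempty.intrinsicInterior (hX.isPolytope hz).convex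
    have hcz := intrinsicInterior_subset hc
    have hφc : φ c = φ (∑ i, m x i) := by
      have h := hcz
      rw [hzeq] at h
      exact (hle_sum x c h.1).antisymm (h.2 _ (hsum_mem x))
    have hev : ∀ᶠ e in nhds c, ∀ y ∈ X, e ∈ minkSum (p y) → c ∈ minkSum (p y) := by
      refine (Filter.eventually_all_finite hX.finite).2 fun y hy => ?_
      by_cases hcy : c ∈ minkSum (p y)
      · exact Filter.Eventually.of_forall fun _ _ => hcy
      · filter_upwards [(hX.isPolytope hy).isCompact.isClosed.isOpen_compl.mem_nhds hcy]
          with e he he'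
        exact absurd he' he
    have hlim : Filter.Tendsto (fun t : ℝ => AffineMap.lineMap c b t)
        (nhdsWithin 0 (Set.Ioi 0)) (nhds c) := by
      have : Continuous fun t : ℝ => AffineMap.lineMap c b t := AffineMap.lineMap_continuous
      simpa using (this.tendsto 0).mono_left nhdsWithin_le_nhds
    obtain ⟨t, hte, ht0, ht1⟩ := ((hlim.eventually hev).and
      (Ioo_mem_nhdsGT (zero_lt_one (α := ℝ)))).exists
    have hmem : AffineMap.lineMap c b t ∈ suppOf p X :=
      hconv.lineMap_mem (hmem_supp hz c hcz) hb ⟨ht0.le, ht1.le⟩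
    obtain ⟨y, hy, hty⟩ := Set.mem_iUnion₂.1 hmem
    have hzy := hX.le_of_mem_intrinsicInterior hz hy hc (hte y hy hty)
    have hzx' := heq_of_le hzx (hφc ▸ hle_sum z c hcz)
    refine ⟨y, hy, fun i => hzx' i ▸ hle hzy i, ?_⟩
    refine lt_of_lt_of_le ?_ (hle_sum y _ hty)
    rw [AffineMap.lineMap_apply]
    simp only [vsub_eq_sub, vadd_eq_add, map_add, map_smul, map_sub, smul_eq_mul, hφc]
    have := mul_pos ht0 (sub_pos.2 hlt)
    linarith
  have hsupp_ne : (suppOf p X).Nonempty := by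
    obtain ⟨x, hx⟩ := hne
    exact ⟨_, hmem_supp hx _ (hsum_mem x)⟩
  obtain ⟨b, hb, hbmax⟩ := hX.isCompact_suppOf.exists_isMaxOn hsupp_ne
    φ.continuous_of_finiteDimensional.continuousOn
  replace hbmax : ∀ c ∈ suppOf p X, φ c ≤ φ b := hbmax
  -- every summand attains its maximal value on a cell reaching the top
  have hreach : ∀ i, ∃ x ∈ X, (∀ y ∈ X, φ (m y i) ≤ φ (m x i)) ∧ φ (∑ i, m x i) = φ b := by
    intro i
    obtain ⟨x₀, hx₀, hx₀max⟩ := Set.exists_max_image X (fun x => φ (m x i)) hX.finite hne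
    obtain ⟨x, ⟨hx, hxi⟩, hxmax⟩ := Set.exists_max_image
      {x ∈ X | φ (m x i) = φ (m x₀ i)} (fun x => φ (∑ i, m x i))
      (hX.finite.subset (Set.sep_subset _ _)) ⟨x₀, hx₀, rfl⟩
    refine ⟨x, hx, fun y hy => hxi ▸ hx₀max y hy, ?_⟩
    refine (hbmax _ (hmem_supp hx _ (hsum_mem x))).antisymm ?_
    by_contra! hlt
    obtain ⟨y, hy, hxy, hlt'⟩ := hclimb hx b hb hlt
    exact (hxmax y ⟨hy, (hx₀max y hy).antisymm (hxi ▸ hxy i)⟩).not_gt hlt'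
  -- all cells inside the top face give the same values
  have hconst : ∀ i, ∀ x ∈ X, ∀ y ∈ X, φ (∑ i, m x i) = φ b → φ (∑ i, m y i) = φ b →
      φ (m x i) = φ (m y i) := by
    intro i x hx y hy hxb hyb
    by_contra hne
    let T := {z ∈ X | ∀ c ∈ minkSum (p z), φ c = φ b}
    have hTfin : T.Finite := hX.finite.subset (Set.sep_subset _ _)
    have hface : ∀ {w}, w ∈ X → φ (∑ i, m w i) = φ b → ∀ c ∈ minkSum (p w), φ c = φ b →
        ∃ z ∈ T, φ (m z i) = φ (m w i) ∧ c ∈ minkSum (p z) := by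
      intro w hw hwb c hc hcb
      obtain ⟨z, hz, hzw, hzeq⟩ := htop hw
      have hzT : ∀ c ∈ minkSum (p z), φ c = φ b := by
        intro e he
        rw [hzeq] at he
        exact ((hle_sum w e he.1).antisymm (he.2 _ (hsum_mem w))).trans hwb
      refine ⟨z, ⟨hz, hzT⟩, heq_of_le hzw ?_ i, ?_⟩
      · rw [hzT _ (hsum_mem z), hwb]
      · rw [hzeq]
        exact ⟨hc, fun e he => (hle_sum w e he).trans (hwb.trans hcb.symm).le⟩
    have hclosed : ∀ q : 𝒜 → Prop, IsClosed (⋃ z ∈ {z ∈ T | q z}, minkSum (p z)) := fun q =>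
      (hTfin.subset (Set.sep_subset _ _)).isClosed_biUnion fun z hz =>
        (hX.isPolytope hz.1.1).isCompact.isClosed
    have hF : IsPreconnected (suppOf p X ∩ {c | φ c = φ b}) :=
      (hconv.inter (convex_hyperplane φ.isLinear _)).isPreconnected
    have hcell : ∀ {w}, w ∈ X → φ (∑ i, m w i) = φ b → ∀ q : 𝒜 → Prop,
        (∀ z, φ (m z i) = φ (m w i) → q z) → ((suppOf p X ∩ {c | φ c = φ b}) ∩
          ⋃ z ∈ {z ∈ T | q z}, minkSum (p z)).Nonempty := by
      intro w hw hwb q hq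
      obtain ⟨z, hz, hzw, hzc⟩ := hface hw hwb _ (hsum_mem w) hwb
      exact ⟨_, ⟨hmem_supp hw _ (hsum_mem w), hwb⟩, Set.mem_biUnion ⟨hz, hq z hzw⟩ hzc⟩
    have hcover : suppOf p X ∩ {c | φ c = φ b} ⊆
        (⋃ z ∈ {z ∈ T | φ (m z i) = φ (m x i)}, minkSum (p z)) ∪
          ⋃ z ∈ {z ∈ T | φ (m z i) ≠ φ (m x i)}, minkSum (p z) := by
      rintro c ⟨hc, hcb⟩
      obtain ⟨w, hw, hcw⟩ := Set.mem_iUnion₂.1 hc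
      have hwb : φ (∑ i, m w i) = φ b := (hbmax _ (hmem_supp hw _ (hsum_mem w))).antisymm
        ((show φ c = φ b from hcb) ▸ hle_sum w c hcw)
      obtain ⟨z, hz, -, hcz⟩ := hface hw hwb c hcw hcb
      by_cases hzx : φ (m z i) = φ (m x i)
      · exact Or.inl (Set.mem_biUnion ⟨hz, hzx⟩ hcz)
      · exact Or.inr (Set.mem_biUnion ⟨hz, hzx⟩ hcz)
    obtain ⟨c, -, hc₁, hc₂⟩ := isPreconnected_closed_iff.1 hF _ _
      (hclosed fun z => φ (m z i) = φ (m x i)) (hclosed fun z => φ (m z i) ≠ φ (m x i)) hcover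
      (hcell hx hxb _ fun z hz => hz) (hcell hy hyb _ fun z hz => hz ▸ Ne.symm hne)
    obtain ⟨z₁, ⟨hz₁, hz₁x⟩, hcz₁⟩ := Set.mem_iUnion₂.1 hc₁
    obtain ⟨z₂, ⟨hz₂, hz₂x⟩, hcz₂⟩ := Set.mem_iUnion₂.1 hc₂
    obtain ⟨w, hw, hwz₁, hcw⟩ := hX.exists_carrier hz₁.1 hcz₁
    have hwz₂ := hX.le_of_mem_intrinsicInterior hw hz₂.1 hcw hcz₂
    have hval : ∀ {z}, z ∈ T → w ≤ z → φ (m w i) = φ (m z i) := fun {z} hz hwz =>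
      heq_of_le hwz (by
        rw [hz.2 _ (hsum_mem z), hz.2 _ (hX.subset_of_le hw hz.1 hwz (hsum_mem w))]) i
    exact hz₂x ((hval hz₂ hwz₂).symm.trans ((hval hz₁ hwz₁).trans hz₁x))
  obtain ⟨x₁, hx₁, hx₁b⟩ : ∃ x ∈ X, φ (∑ i, m x i) = φ b := by
    obtain ⟨x, hx, hbx⟩ := Set.mem_iUnion₂.1 hb
    exact ⟨x, hx, (hbmax _ (hmem_supp hx _ (hsum_mem x))).antisymm (hle_sum x b hbx)⟩
  have hmax₁ : ∀ i, ∀ y ∈ X, φ (m y i) ≤ φ (m x₁ i) := by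
    intro i y hy
    obtain ⟨x, hx, hxmax, hxb⟩ := hreach i
    exact hconst i x hx x₁ hx₁ hxb hx₁b ▸ hxmax y hy
  obtain ⟨g, hg, rfl⟩ := mem_minkSum.1 ha
  have hag : φ (∑ i, g i) ≤ φ (∑ i, m x₁ i) := by
    simp only [map_sum]
    refine Finset.sum_le_sum fun i _ => ?_
    obtain ⟨y, hy, hgy⟩ := Set.mem_iUnion₂.1 (hg i)
    exact (hmax y i _ hgy).trans (hmax₁ i y hy)
  have := hφu b hb
  linarith

theorem statement5 (d n : ℕ) (hn : 0 < n) {𝒜 𝒜' : Type*} [PartialOrder 𝒜] [PartialOrder 𝒜']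
    (p : 𝒜 → Fin n → Set (Fin d → ℝ)) (p' : 𝒜' → Fin n → Set (Fin d → ℝ))
    (hpoly : ∀ x i, IsPolytope (p x i))
    (hmono : ∀ x y : 𝒜, x ≤ y → NPFace (p x) (p y))
    (hpoly' : ∀ x i, IsPolytope (p' x i))
    (hmono' : ∀ x y : 𝒜', x ≤ y → NPFace (p' x) (p' y))
    -- `Sd` is a canonical subdivision over `n𝒫`: a monotone map `𝒜 → Subd(𝒜')` with
    -- `n`-support of `Sd x` equal to `p x`.
    (Sd : 𝒜 → Set 𝒜')
    (hsubd : ∀ x, IsASubdivision p' (Sd x))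
    (hns : ∀ x, nsuppOf p' (Sd x) = p x)
    (hSdmono : ∀ x y : 𝒜, y ≤ x → SubdLE p' (Sd y) (Sd x)) :
    -- `Σ*(X) = ⋃_{x ∈ X} Sd x` is an `𝒜'`-complex with `n`-support `|X|ₙ` …
    (∀ X : Set 𝒜, IsAComplex p X →
      IsAComplex p' (⋃ x ∈ X, Sd x) ∧ nsuppOf p' (⋃ x ∈ X, Sd x) = nsuppOf p X) ∧
    -- … and `Σ*` is a canonical subdivision `Subd(𝒜) → Subd(𝒜')` over `n𝒫`:
    (∀ X : Set 𝒜, IsASubdivision p X → IsASubdivision p' (⋃ x ∈ X, Sd x)) ∧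
    (∀ X X' : Set 𝒜, IsASubdivision p X → IsASubdivision p X' → SubdLE p X' X →
      SubdLE p' (⋃ x ∈ X', Sd x) (⋃ x ∈ X, Sd x)) := by
  have hsupp : ∀ x, suppOf p' (Sd x) = minkSum (p x) := by
    intro x
    have hne : (Sd x).Nonempty := by
      obtain ⟨a, ha⟩ := (hsubd x).2.nonempty
      obtain ⟨y, hy, -⟩ := Set.mem_iUnion₂.1 ha
      exact ⟨y, hy⟩
    rw [← (hsubd x).1.minkSum_nsuppOf hpoly' hmono' (hsubd x).2.convex hne, hns]
  have hsuppX : ∀ X : Set 𝒜, suppOf p' (⋃ x ∈ X, Sd x) = suppOf p X := by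
    intro X
    simp only [suppOf, ← hsupp, Set.biUnion_iUnion]
  have hcomplex : ∀ X : Set 𝒜, IsAComplex p X → IsAComplex p' (⋃ x ∈ X, Sd x) := by
    intro X hX
    have huniq : ∀ y ∈ ⋃ x ∈ X, Sd x, ∀ y' ∈ ⋃ x ∈ X, Sd x, ∀ a,
        a ∈ intrinsicInterior ℝ (minkSum (p' y)) → a ∈ intrinsicInterior ℝ (minkSum (p' y')) →
          y = y' := by
      intro y hy y' hy' a ha ha'
      obtain ⟨x, hx, hyx⟩ := Set.mem_iUnion₂.1 hy
      obtain ⟨x', hx', hyx'⟩ := Set.mem_iUnion₂.1 hy'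
      have hmem : ∀ {y x}, y ∈ Sd x → a ∈ intrinsicInterior ℝ (minkSum (p' y)) →
          a ∈ minkSum (p x) := fun {y x} hyx ha =>
        hsupp x ▸ Set.mem_biUnion hyx (intrinsicInterior_subset ha)
      obtain ⟨z, hz, hzx, haz⟩ := hX.exists_carrier hx (hmem hyx ha)
      have hzx' := hX.le_of_mem_intrinsicInterior hz hx' haz (hmem hyx' ha')
      have haz' := intrinsicInterior_subset haz
      rw [← hsupp z] at haz'
      obtain ⟨w, hw, haw⟩ := Set.mem_iUnion₂.1 haz'
      obtain ⟨v, hv, -, hav⟩ := (hsubd z).1.exists_carrier hw haw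
      exact ((hsubd x).1.eq_of_mem_intrinsicInterior hyx ((hSdmono x z hzx).1 hv) ha hav).trans
        ((hsubd x').1.eq_of_mem_intrinsicInterior ((hSdmono x' z hzx').1 hv) hyx' hav ha')
    have hpolytope : ∀ y ∈ ⋃ x ∈ X, Sd x, IsPolytope (minkSum (p' y)) := by
      intro y hy
      obtain ⟨x, -, hyx⟩ := Set.mem_iUnion₂.1 hy
      exact (hsubd x).1.isPolytope hyx
    have hface : ∀ y ∈ ⋃ x ∈ X, Sd x, ∀ F, IsFaceOf F (minkSum (p' y)) →
        ∃ z ∈ ⋃ x ∈ X, Sd x, z ≤ y ∧ minkSum (p' z) = F := by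
      intro y hy F hF
      obtain ⟨x, hx, hyx⟩ := Set.mem_iUnion₂.1 hy
      obtain ⟨z, hz, hzy, hzF⟩ := (hsubd x).1.exists_le_of_isFaceOf hyx hF
      exact ⟨z, Set.mem_biUnion hx hz, hzy, hzF⟩
    have hinj : Set.InjOn (fun y => minkSum (p' y)) (⋃ x ∈ X, Sd x) := by
      intro y hy y' hy' heq
      have hP := hpolytope y hy
      obtain ⟨a, ha⟩ := hP.nonempty.intrinsicInterior hP.convex
      exact huniq y hy y' hy' a ha ((show minkSum (p' y) = minkSum (p' y') from heq) ▸ ha)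
    refine ⟨⟨?_, ?_, ?_, ?_⟩, hinj, ?_⟩
    · exact (hX.finite.biUnion fun x _ => (hsubd x).1.finite).image _
    · rintro _ ⟨y, hy, rfl⟩
      exact hpolytope y hy
    · rintro _ ⟨y, hy, rfl⟩ F hF
      obtain ⟨z, hz, -, hzF⟩ := hface y hy F hF
      exact ⟨z, hz, hzF⟩
    · rintro _ ⟨y, hy, rfl⟩ _ ⟨y', hy', rfl⟩ hne
      refine Set.eq_empty_of_forall_notMem fun a ha => hne ?_
      rw [huniq y hy y' hy' a ha.1 ha.2]
    · intro y hy y' hy'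
      refine ⟨fun h => (hmono' y y' h).isFaceOf_minkSum, fun h => ?_⟩
      obtain ⟨z, hz, hzy', hzy⟩ := hface y' hy' _ h
      exact hinj hz hy hzy ▸ hzy'
  refine ⟨fun X hX => ⟨hcomplex X hX, ?_⟩, fun X hX => ⟨hcomplex X hX.1, ?_⟩,
    fun X X' hX hX' h => ⟨Set.biUnion_subset_biUnion_left h.1, hcomplex X' hX'.1, ?_⟩⟩
  · funext k
    simp only [nsuppOf, ← hns, Set.biUnion_iUnion]
  · rw [hsuppX]
    exact hX.2
  · rw [hsuppX, hsuppX]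
    exact h.2.2
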